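/- Let G be a finite simple graph on n vertices with maximum degree Δ(G) ≥ n/2. Then G admits an equitable ⌈(Δ(G)+1)/2⌉-tree-coloring; equivalently, a_eq(G) ≤ ⌈(Δ(G)+1)/2⌉. -/

import Mathlib

/-- An *equitable `k`-tree-coloring* of a graph `G` on `n` vertices: a partition of the
vertex set into `k` classes (fibers of a map to `Fin k`), each of size `⌊n/k⌋` or `⌈n/k⌉`,
such that each class induces a forest (acyclic subgraph) of `G`. -/
def SimpleGraph.EquitableTreeColoring {V : Type*} [Fintype V] (G : SimpleGraph V)
    (k : ℕ) : Prop :=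
  ∃ f : V → Fin k,
    (∀ i : Fin k,
      (Finset.univ.filter fun v => f v = i).card = Fintype.card V / k ∨
      (Finset.univ.filter fun v => f v = i).card = (Fintype.card V + k - 1) / k) ∧
    ∀ i : Fin k, (G.induce (f ⁻¹' {i})).IsAcyclic

/-- A graph that maps injectively and homomorphically to the integer path is acyclic. -/
theorem aux_acyclic_of_path {W : Type*} (G : SimpleGraph W) (φ : W → ℕ)
    (hφ : Function.Injective φ)
    (hadj : ∀ x y, G.Adj x y → φ x + 1 = φ y ∨ φ y + 1 = φ x) : G.IsAcyclic := by
  have key : ∀ x y, φ x + 1 = φ y → ¬ (G.deleteEdges {s(x, y)}).Reachable x y := by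
    rintro x y hxy ⟨p⟩
    have : ∀ u v, (G.deleteEdges {s(x, y)}).Walk u v → φ u ≤ φ x → φ v ≤ φ x := by
      intro u v p
      induction p with
      | nil => exact id
      | @cons a b c hab p ih =>
        intro ha
        apply ih
        rw [SimpleGraph.deleteEdges_adj] at hab
        obtain ⟨h1, h2⟩ := hab
        by_contra hb
        rcases hadj _ _ h1 with h | h
        · have e1 : φ a = φ x := by omega
          have e2 : φ b = φ y := by omega
          rw [hφ e1, hφ e2] at h2
          exact h2 rfl
        · omega
    have := this x y p le_rfl
    omega
  rw [SimpleGraph.isAcyclic_iff_forall_adj_isBridge]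
  intro x y h
  rw [SimpleGraph.isBridge_iff]
  rcases hadj _ _ h with h | h
  · exact key x y h
  · intro hr
    apply key y x h
    rw [Sym2.eq_swap]
    exact hr.symm

theorem aux_acyclic4 {V : Type*} (G : SimpleGraph V) (S : Set V) (p q r s : V)
    (hS : ∀ v ∈ S, v = p ∨ v = q ∨ v = r ∨ v = s)
    (h1 : ¬ G.Adj p q) (h2 : ¬ G.Adj q r) (h3 : ¬ G.Adj r s) : (G.induce S).IsAcyclic := by
  classical
  have h1' : ¬ G.Adj q p := fun h => h1 h.symm
  have h2' : ¬ G.Adj r q := fun h => h2 h.symm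
  have h3' : ¬ G.Adj s r := fun h => h3 h.symm
  have hl : ∀ x, ¬ G.Adj x x := fun x => G.loopless.irrefl x
  refine aux_acyclic_of_path _
    (fun v => if v.1 = r then 0 else if v.1 = p then 1 else if v.1 = s then 2 else 3) ?_ ?_
  · rintro ⟨x, hx⟩ ⟨y, hy⟩ h
    have hx := hS x hx
    have hy := hS y hy
    simp only [Subtype.mk.injEq]
    grind
  · rintro ⟨x, hx⟩ ⟨y, hy⟩ h
    have hx := hS x hx
    have hy := hS y hy
    simp only [SimpleGraph.comap_adj, Function.Embedding.subtype_apply] at h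
    grind

theorem aux_acyclic3 {V : Type*} (G : SimpleGraph V) (S : Set V) (x y z : V)
    (hS : ∀ v ∈ S, v = x ∨ v = y ∨ v = z)
    (h1 : ¬ G.Adj x y) : (G.induce S).IsAcyclic := by
  classical
  have h1' : ¬ G.Adj y x := fun h => h1 h.symm
  have hl : ∀ x, ¬ G.Adj x x := fun x => G.loopless.irrefl x
  refine aux_acyclic_of_path _
    (fun v => if v.1 = x then 0 else if v.1 = y then 2 else 1) ?_ ?_
  · rintro ⟨a, hx⟩ ⟨b, hy⟩ h
    have hx := hS a hx
    have hy := hS b hy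
    simp only [Subtype.mk.injEq]
    grind
  · rintro ⟨a, hx⟩ ⟨b, hy⟩ h
    have hx := hS a hx
    have hy := hS b hy
    simp only [SimpleGraph.comap_adj, Function.Embedding.subtype_apply] at h
    grind

theorem aux_sum_fiber {α β ι : Type*} [Fintype α] [Fintype β] [DecidableEq ι]
    (p : α → ι) (q : β → ι) (i : ι) :
    (Finset.univ.filter fun x : α ⊕ β => Sum.elim p q x = i).card
      = (Finset.univ.filter fun x => p x = i).card
        + (Finset.univ.filter fun x => q x = i).card := by
  rw [Finset.card_filter, Fintype.sum_sum_type, Finset.card_filter, Finset.card_filter]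
  rfl

/-- Extending a partial colouring to one with prescribed class sizes. -/
theorem aux_extend {V ι α : Type*} [Fintype V] [Fintype ι] [DecidableEq ι] [Fintype α]
    (e : α → V) (he : Function.Injective e) (col : α → ι) (t : ι → ℕ)
    (ht : ∑ i, t i = Fintype.card V)
    (hc : ∀ i, (Finset.univ.filter fun a => col a = i).card ≤ t i) :
    ∃ f : V → ι, (∀ a, f (e a) = col a) ∧
      ∀ i, (Finset.univ.filter fun v => f v = i).card = t i := by
  classical
  set r : ι → ℕ := fun i => t i - (Finset.univ.filter fun a => col a = i).card with hr
  have hsum : ∑ i, (Finset.univ.filter fun a => col a = i).card = Fintype.card α := by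
    rw [← Finset.card_eq_sum_card_fiberwise (fun _ _ => Finset.mem_coe.2 (Finset.mem_univ _))]
    rfl
  have hcard : Fintype.card (α ⊕ (Σ i, Fin (r i))) = Fintype.card V := by
    rw [Fintype.card_sum, Fintype.card_sigma, ← ht, ← hsum]
    simp only [Fintype.card_fin]
    rw [← Finset.sum_add_distrib]
    exact Finset.sum_congr rfl fun i _ => by have := hc i; simp only [hr]; omega
  have hcompl : Fintype.card {v // v ∉ Set.range e} = Fintype.card (Σ i, Fin (r i)) := by
    rw [Fintype.card_subtype_compl, Fintype.card_sum] at *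
    have : Fintype.card {v // v ∈ Set.range e} = Fintype.card α :=
      (Fintype.card_congr (Equiv.ofInjective e he)).symm
    omega
  let E1 : {v // v ∉ Set.range e} ≃ (Σ i, Fin (r i)) := Fintype.equivOfCardEq hcompl
  let E : α ⊕ (Σ i, Fin (r i)) ≃ V :=
    ((Equiv.ofInjective e he).sumCongr E1.symm).trans (Equiv.sumCompl (fun v => v ∈ Set.range e))
  have hE : ∀ a, E (Sum.inl a) = e a := fun a => by simp [E]
  refine ⟨fun v => Sum.elim col (fun s => s.1) (E.symm v), ?_, ?_⟩
  · intro a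
    rw [← hE a]; simp
  · intro i
    have : (Finset.univ.filter fun v => Sum.elim col (fun s => s.1) (E.symm v) = i).card
        = (Finset.univ.filter fun x : α ⊕ (Σ i, Fin (r i)) =>
            Sum.elim col (fun s => s.1) x = i).card := by
      apply Finset.card_equiv E.symm
      simp
    rw [this, aux_sum_fiber]
    have h2 : Fintype.card {s : Σ i, Fin (r i) // s.1 = i} = r i := by
      rw [Fintype.card_congr (Equiv.sigmaSubtype i), Fintype.card_fin]
    rw [Fintype.card_subtype] at h2
    rw [h2]
    have := hc i
    simp only [hr]; omega

/-- Greedy matching lemma. -/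
theorem aux_matching {V : Type*} [Fintype V] (H : SimpleGraph V) [DecidableRel H.Adj] (d : ℕ)
    (hd : ∀ v, d ≤ H.degree v) (hn : 2 * d ≤ Fintype.card V) :
    ∃ a b : Fin d → V, Function.Injective (Sum.elim a b) ∧ ∀ i, H.Adj (a i) (b i) := by
  classical
  suffices h : ∀ s ≤ d, ∃ a b : Fin s → V,
      (Function.Injective a ∧ Function.Injective b ∧ ∀ i j, a i ≠ b j) ∧
      ∀ i, H.Adj (a i) (b i) by
    obtain ⟨a, b, h1, h2⟩ := h d le_rfl
    exact ⟨a, b, h1.1.sumElim h1.2.1 h1.2.2, h2⟩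
  intro s
  induction s with
  | zero =>
    intro _
    exact ⟨Fin.elim0, Fin.elim0, ⟨fun i => i.elim0, fun i => i.elim0, fun i => i.elim0⟩,
      fun i => i.elim0⟩
  | succ s ih =>
    intro hs
    obtain ⟨a, b, ⟨ha, hb, hab⟩, hadj⟩ := ih (by omega)
    set R : Finset V := Finset.univ.image a ∪ Finset.univ.image b with hR
    have haR : ∀ i, a i ∈ R := fun i => by simp [hR]
    have hbR : ∀ i, b i ∈ R := fun i => by simp [hR]
    have hRc : R.card ≤ 2 * s := by
      refine (Finset.card_union_le _ _).trans ?_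
      have h1 := Finset.card_image_le (s := (Finset.univ : Finset (Fin s))) (f := a)
      have h2 := Finset.card_image_le (s := (Finset.univ : Finset (Fin s))) (f := b)
      simp only [Finset.card_univ, Fintype.card_fin] at h1 h2
      omega
    have hRcompl : 1 < (Rᶜ).card := by
      rw [Finset.card_compl]; omega
    obtain ⟨u, hu, v, hv, huv⟩ := Finset.one_lt_card.1 hRcompl
    rw [Finset.mem_compl] at hu hv
    have ext : ∀ x y, x ∉ R → y ∉ R → H.Adj x y → ∃ a b : Fin (s+1) → V,
      (Function.Injective a ∧ Function.Injective b ∧ ∀ i j, a i ≠ b j) ∧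
      ∀ i, H.Adj (a i) (b i) := by
      intro x y hx hy hxy
      have := hxy.ne
      refine ⟨Fin.cons x a, Fin.cons y b, ⟨?_, ?_, ?_⟩, ?_⟩
      · rw [Fin.cons_injective_iff]
        exact ⟨by rintro ⟨i, rfl⟩; exact hx (haR i), ha⟩
      · rw [Fin.cons_injective_iff]
        exact ⟨by rintro ⟨i, rfl⟩; exact hy (hbR i), hb⟩
      · intro i j
        refine Fin.cases ?_ (fun i => ?_) i <;> refine Fin.cases ?_ (fun j => ?_) j <;>
          simp only [Fin.cons_zero, Fin.cons_succ]
        · exact this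
        · rintro rfl; exact hx (hbR j)
        · rintro rfl; exact hy (haR i)
        · exact hab i j
      · intro i
        refine Fin.cases ?_ (fun i => ?_) i
        · simpa using hxy
        · simpa using hadj i
    have aug : ∀ u v i, u ≠ v → u ∉ R → v ∉ R → H.Adj u (a i) → H.Adj v (b i) →
      ∃ a b : Fin (s+1) → V,
      (Function.Injective a ∧ Function.Injective b ∧ ∀ i j, a i ≠ b j) ∧
      ∀ i, H.Adj (a i) (b i) := by
      intro u v i huv hu hv h1 h2
      have hua : ∀ j, u ≠ a j := by rintro j rfl; exact hu (haR j)
      have hub : ∀ j, u ≠ b j := by rintro j rfl; exact hu (hbR j)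
      have hva : ∀ j, v ≠ a j := by rintro j rfl; exact hv (haR j)
      have hvb : ∀ j, v ≠ b j := by rintro j rfl; exact hv (hbR j)
      refine ⟨Fin.cons v a, Fin.cons (b i) (Function.update b i u), ⟨?_, ?_, ?_⟩, ?_⟩
      · rw [Fin.cons_injective_iff]
        exact ⟨by rintro ⟨i, rfl⟩; exact hv (haR i), ha⟩
      · rw [Fin.cons_injective_iff]
        constructor
        · rintro ⟨j, hj⟩
          by_cases hji : j = i
          · subst hji; simp at hj; exact hub _ hj
          · rw [Function.update_of_ne hji] at hj; exact hji (hb hj)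
        · intro x y hxy
          simp only [Function.update_apply] at hxy
          grind [Function.Injective]
      · intro x y
        refine Fin.cases ?_ (fun x => ?_) x <;> refine Fin.cases ?_ (fun y => ?_) y <;>
          simp only [Fin.cons_zero, Fin.cons_succ, Function.update_apply]
        · exact hvb i
        · split_ifs
          · exact huv.symm
          · exact hvb _
        · exact hab x i
        · split_ifs
          · exact (hua _).symm
          · exact hab _ _
      · intro x
        refine Fin.cases ?_ (fun x => ?_) x
        · simpa using h2
        · simp only [Fin.cons_succ, Function.update_apply]
          split_ifs with hx
          · subst hx; exact h1.symm
          · exact hadj x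
    by_contra hno
    have hN : ∀ x, x ∉ R → H.neighborFinset x ⊆ R := by
      intro x hx y hy
      by_contra hyR
      exact hno (ext x y hx hyR (by simpa using hy))
    -- the degree of a vertex outside `R` as a sum over matching edges
    have hdeg : ∀ x, x ∉ R → d ≤ ∑ i, ((if H.Adj x (a i) then 1 else 0) +
        (if H.Adj x (b i) then 1 else 0)) := by
      intro x hx
      refine (hd x).trans ?_
      rw [← SimpleGraph.card_neighborFinset_eq_degree, Finset.sum_add_distrib,
        ← Finset.card_filter, ← Finset.card_filter]
      have hsub : H.neighborFinset x ⊆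
          (Finset.univ.filter fun i => H.Adj x (a i)).image a ∪
          (Finset.univ.filter fun i => H.Adj x (b i)).image b := by
        intro y hy
        have hyR := hN x hx hy
        rw [SimpleGraph.mem_neighborFinset] at hy
        simp only [hR, Finset.mem_union, Finset.mem_image, Finset.mem_univ, true_and,
          Finset.mem_filter] at hyR ⊢
        rcases hyR with ⟨i, rfl⟩ | ⟨i, rfl⟩
        · exact Or.inl ⟨i, hy, rfl⟩
        · exact Or.inr ⟨i, hy, rfl⟩
      refine (Finset.card_le_card hsub).trans ((Finset.card_union_le _ _).trans ?_)
      exact Nat.add_le_add Finset.card_image_le Finset.card_image_le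
    have h1 := hdeg u hu
    have h2 := hdeg v hv
    have h3 : ∑ i : Fin s, (((if H.Adj u (a i) then 1 else 0) + (if H.Adj u (b i) then 1 else 0))
        + ((if H.Adj v (a i) then 1 else 0) + (if H.Adj v (b i) then 1 else 0))) ≤
        ∑ i : Fin s, 2 := by
      refine Finset.sum_le_sum fun i _ => ?_
      have e1 : ¬ (H.Adj u (a i) ∧ H.Adj v (b i)) :=
        fun h => hno (aug u v i huv hu hv h.1 h.2)
      have e2 : ¬ (H.Adj v (a i) ∧ H.Adj u (b i)) :=
        fun h => hno (aug v u i huv.symm hv hu h.1 h.2)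
      clear h1 h2
      by_cases q1 : H.Adj u (a i) <;> by_cases q2 : H.Adj u (b i) <;>
        by_cases q3 : H.Adj v (a i) <;> by_cases q4 : H.Adj v (b i) <;>
        simp only [q1, q2, q3, q4, and_self, not_true_eq_false, if_true, if_false] at e1 e2 ⊢ <;>
        norm_num
    rw [Finset.sum_add_distrib] at h3
    simp only [Finset.sum_const, Finset.card_univ, Fintype.card_fin, smul_eq_mul] at h3
    omega

theorem aux_fiber_sum {s : ℕ} {ι : Type*} [DecidableEq ι] (q : Fin s → ι) (i : ι) :
    (Finset.univ.filter fun x : Fin s ⊕ Fin s => Sum.elim q q x = i).card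
      = 2 * (Finset.univ.filter fun x => q x = i).card := by
  rw [aux_sum_fiber, two_mul]

theorem aux_card_lt {k m : ℕ} (hm : m ≤ k) :
    (Finset.univ.filter fun i : Fin k => i.val < m).card = m := by
  have : (Finset.univ.filter fun i : Fin k => i.val < m)
      = Finset.univ.image (Fin.castLE hm) := by
    ext i
    simp only [Finset.mem_filter, Finset.mem_univ, true_and, Finset.mem_image]
    constructor
    · intro h; exact ⟨⟨i, h⟩, rfl⟩
    · rintro ⟨j, rfl⟩; simp
  rw [this, Finset.card_image_of_injective _ (Fin.castLE_injective hm)]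
  simp

theorem aux_target {k m c : ℕ} (hm : m ≤ k) :
    ∑ i : Fin k, (c + if i.val < m then 1 else 0) = k * c + m := by
  rw [Finset.sum_add_distrib, ← Finset.card_filter, aux_card_lt hm]
  simp

theorem aux_castLE_fiber {k m : ℕ} (hm : m ≤ k) (i : Fin k) :
    (Finset.univ.filter fun x : Fin m => Fin.castLE hm x = i).card
      = if i.val < m then 1 else 0 := by
  split_ifs with h
  · rw [Finset.card_eq_one]
    refine ⟨⟨i, h⟩, ?_⟩
    ext x
    simp [Fin.ext_iff]
  · rw [Finset.card_eq_zero]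
    ext x
    have := x.2
    simp [Fin.ext_iff]
    omega

theorem aux_acyclic_fiber3 {V : Type*} [Fintype V] (G : SimpleGraph V) {k : ℕ} (f : V → Fin k)
    (i : Fin k) (hc : (Finset.univ.filter fun v => f v = i).card = 3) (x y : V)
    (hx : f x = i) (hy : f y = i) (hxy : x ≠ y) (h : ¬ G.Adj x y) :
    (G.induce (f ⁻¹' {i})).IsAcyclic := by
  classical
  have hsub : ({x, y} : Finset V) ⊆ Finset.univ.filter fun v => f v = i := by
    intro z; simp only [Finset.mem_insert, Finset.mem_singleton, Finset.mem_filter]; grind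
  have h1 : ((Finset.univ.filter fun v => f v = i) \ {x, y}).card = 1 := by
    rw [Finset.card_sdiff_of_subset hsub, hc, Finset.card_pair hxy]
  obtain ⟨z, hz⟩ := Finset.card_eq_one.1 h1
  refine aux_acyclic3 G _ x y z ?_ h
  intro v hv
  have hv : f v = i := hv
  have : v ∈ (Finset.univ.filter fun v => f v = i) \ {x, y} ↔ v ∈ ({z} : Finset V) := by rw [hz]
  simp only [Finset.mem_sdiff, Finset.mem_filter, Finset.mem_univ, true_and, Finset.mem_insert,
    Finset.mem_singleton, hv] at this
  tauto

theorem aux_acyclic_fiber4 {V : Type*} [Fintype V] (G : SimpleGraph V) {k : ℕ} (f : V → Fin k)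
    (i : Fin k) (hc : (Finset.univ.filter fun v => f v = i).card = 4) (p q r s : V)
    (hp : f p = i) (hq : f q = i) (hr : f r = i) (hs : f s = i)
    (hpq : p ≠ q) (hpr : p ≠ r) (hps : p ≠ s) (hqr : q ≠ r) (hqs : q ≠ s) (hrs : r ≠ s)
    (h1 : ¬ G.Adj p q) (h3 : ¬ G.Adj r s)
    (h : ¬ G.Adj p r ∨ ¬ G.Adj p s ∨ ¬ G.Adj q r ∨ ¬ G.Adj q s) :
    (G.induce (f ⁻¹' {i})).IsAcyclic := by
  classical
  have hsub : ({p, q, r, s} : Finset V) ⊆ Finset.univ.filter fun v => f v = i := by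
    intro z; simp only [Finset.mem_insert, Finset.mem_singleton, Finset.mem_filter]; grind
  have heq := Finset.eq_of_subset_of_card_le hsub (by
    rw [hc]; simp [Finset.card_insert_of_notMem, *])
  have hS : ∀ v ∈ f ⁻¹' {i}, v = p ∨ v = q ∨ v = r ∨ v = s := by
    intro v hv
    have hv : f v = i := hv
    have : v ∈ ({p, q, r, s} : Finset V) := by rw [heq]; simp [hv]
    simpa using this
  have h1' : ¬ G.Adj q p := fun h => h1 h.symm
  have h3' : ¬ G.Adj s r := fun h => h3 h.symm
  rcases h with h | h | h | h
  · exact aux_acyclic4 G _ q p r s (fun v hv => by have := hS v hv; tauto) h1' h h3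
  · exact aux_acyclic4 G _ q p s r (fun v hv => by have := hS v hv; tauto) h1' h h3'
  · exact aux_acyclic4 G _ p q r s (fun v hv => by have := hS v hv; tauto) h1 h h3
  · exact aux_acyclic4 G _ p q s r (fun v hv => by have := hS v hv; tauto) h1 h h3'

theorem aux_acyclic_fiber2 {V : Type*} [Fintype V] (G : SimpleGraph V) {k : ℕ} (f : V → Fin k)
    (i : Fin k) (hc : (Finset.univ.filter fun v => f v = i).card ≤ 2) :
    (G.induce (f ⁻¹' {i})).IsAcyclic := by
  classical
  apply SimpleGraph.IsAcyclic.of_card_le_two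
  rw [ENat.card_eq_coe_fintype_card]
  have : Fintype.card (f ⁻¹' {i}) = (Finset.univ.filter fun v => f v = i).card := by
    rw [← Fintype.card_subtype]
    exact Fintype.card_congr (Equiv.refl _)
  rw [this]
  exact_mod_cast hc

/-- The second application of the matching lemma. -/
theorem aux_double {V : Type*} [Fintype V] (H : SimpleGraph V) [DecidableRel H.Adj] (k m : ℕ)
    (hmk : m ≤ k) (hn : Fintype.card V = 3 * k + m) (hd : ∀ v, k + m ≤ H.degree v)
    (a b : Fin (k + m) → V) (hinj : Function.Injective (Sum.elim a b)) :
    ∃ c d : Fin m → Fin (k + m), Function.Injective (Sum.elim c d) ∧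
      ∀ i, H.Adj (a (c i)) (a (d i)) ∨ H.Adj (a (c i)) (b (d i)) ∨
        H.Adj (b (c i)) (a (d i)) ∨ H.Adj (b (c i)) (b (d i)) := by
  classical
  let A : SimpleGraph (Fin (k + m)) :=
    { Adj := fun i j => i ≠ j ∧ (H.Adj (a i) (a j) ∨ H.Adj (a i) (b j) ∨
        H.Adj (b i) (a j) ∨ H.Adj (b i) (b j))
      symm := ⟨by
        rintro i j ⟨h, h'⟩
        refine ⟨h.symm, ?_⟩
        simp only [H.adj_comm (a j), H.adj_comm (b j)]
        tauto⟩
      loopless := ⟨fun i h => h.1 rfl⟩ }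
  have hA : ∀ i j, A.Adj i j ↔ i ≠ j ∧ (H.Adj (a i) (a j) ∨ H.Adj (a i) (b j) ∨
        H.Adj (b i) (a j) ∨ H.Adj (b i) (b j)) := fun i j => Iff.rfl
  obtain ⟨c, d, h1, h2⟩ := aux_matching A m (by
    intro i
    set N := A.neighborFinset i with hN
    have hsub : H.neighborFinset (a i) ⊆
        (Finset.univ.image (Sum.elim a b))ᶜ ∪ {b i} ∪ (N.image a ∪ N.image b) := by
      intro y hy
      rw [SimpleGraph.mem_neighborFinset] at hy
      by_cases hyR : y ∈ Finset.univ.image (Sum.elim a b)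
      · simp only [Finset.mem_image, Finset.mem_univ, true_and, Sum.exists, Sum.elim_inl,
          Sum.elim_inr] at hyR
        simp only [Finset.mem_union, Finset.mem_image, Finset.mem_singleton, hN,
          SimpleGraph.mem_neighborFinset, hA]
        rcases hyR with ⟨j, rfl⟩ | ⟨j, rfl⟩
        · have : i ≠ j := by rintro rfl; exact hy.ne rfl
          exact Or.inr (Or.inl ⟨j, ⟨this, by tauto⟩, rfl⟩)
        · by_cases hij : i = j
          · subst hij; simp
          · exact Or.inr (Or.inr ⟨j, ⟨hij, by tauto⟩, rfl⟩)
      · simp only [Finset.mem_union, Finset.mem_compl]; tauto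
    have hle := Finset.card_le_card hsub
    have e1 := Finset.card_union_le ((Finset.univ.image (Sum.elim a b))ᶜ ∪ {b i})
      (N.image a ∪ N.image b)
    have e2 := Finset.card_union_le ((Finset.univ.image (Sum.elim a b))ᶜ) {b i}
    have e3 := Finset.card_union_le (N.image a) (N.image b)
    have e4 := Finset.card_image_le (s := N) (f := a)
    have e5 := Finset.card_image_le (s := N) (f := b)
    have e6 : (Finset.univ.image (Sum.elim a b)).card = 2 * (k + m) := by
      rw [Finset.card_image_of_injective _ hinj]
      simp; omega
    rw [Finset.card_compl, e6, hn, Finset.card_singleton] at e2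
    rw [SimpleGraph.card_neighborFinset_eq_degree] at hle
    have := hd (a i)
    rw [← SimpleGraph.card_neighborFinset_eq_degree]
    change m ≤ N.card
    omega) (by simp; omega)
  exact ⟨c, d, h1, fun i => (h2 i).2⟩

/-- If `Δ(G) ≥ n/2`, then `G` admits an equitable `⌈(Δ(G)+1)/2⌉`-tree-coloring,
i.e. `a_eq(G) ≤ ⌈(Δ(G)+1)/2⌉`. -/
theorem equitableTreeColoring_of_half_card_le_maxDegree
    {V : Type*} [Fintype V] (G : SimpleGraph V) [DecidableRel G.Adj]
    (h : (G.maxDegree : ℝ) ≥ Fintype.card V / 2) :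
    G.EquitableTreeColoring ((G.maxDegree + 2) / 2) := by
  classical
  have h2 : Fintype.card V ≤ 2 * G.maxDegree := by
    have : (Fintype.card V : ℝ) ≤ 2 * G.maxDegree := by linarith
    exact_mod_cast this
  obtain ⟨k, hk⟩ : ∃ k, k = (G.maxDegree + 2) / 2 := ⟨_, rfl⟩
  rw [← hk]
  obtain ⟨n, hn⟩ : ∃ n, n = Fintype.card V := ⟨_, rfl⟩
  have hk0 : 0 < k := by omega
  have hn4 : n < 4 * k := by omega
  have hdeg : ∀ v, n - 2 * k ≤ Gᶜ.degree v := by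
    intro v
    rw [SimpleGraph.degree_compl]
    have := G.degree_le_maxDegree v
    omega
  obtain ⟨c, hc⟩ : ∃ c, c = n / k := ⟨_, rfl⟩
  obtain ⟨m, hm⟩ : ∃ m, m = n % k := ⟨_, rfl⟩
  have hmk : m < k := hm ▸ Nat.mod_lt _ hk0
  have hnk : k * c + m = n := by rw [hc, hm]; exact Nat.div_add_mod n k
  have hc4 : c < 4 := by rw [hc]; exact (Nat.div_lt_iff_lt_mul hk0).2 hn4
  -- it is enough to find a colouring with these class sizes
  suffices hs : ∃ f : V → Fin k,
      (∀ i : Fin k, (Finset.univ.filter fun v => f v = i).card = c + if i.val < m then 1 else 0) ∧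
      ∀ i : Fin k, (G.induce (f ⁻¹' {i})).IsAcyclic by
    obtain ⟨f, hf1, hf2⟩ := hs
    refine ⟨f, fun i => ?_, hf2⟩
    rw [hf1 i, ← hn, ← hc]
    split_ifs with hi
    · right
      symm
      rw [Nat.div_eq_iff hk0]
      have : (c + 1) * k = k * c + k := by ring
      constructor <;> omega
    · left; rfl
  have hsum : ∑ i : Fin k, (c + if i.val < m then 1 else 0) = Fintype.card V := by
    rw [aux_target hmk.le, hnk, hn]
  have hcases : c ≤ 1 ∨ c = 2 ∨ c = 3 := by omega
  rcases hcases with hc1 | rfl | rfl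
  · obtain ⟨f, -, hf⟩ := aux_extend (fun x : Empty => (x.elim : V)) (fun x => x.elim)
      (fun x => (x.elim : Fin k)) _ hsum (by intro i; simp)
    refine ⟨f, hf, fun i => aux_acyclic_fiber2 G f i ?_⟩
    rw [hf i]; split_ifs <;> omega
  · obtain ⟨a, b, hinj, hab⟩ := aux_matching Gᶜ m
      (fun v => by have := hdeg v; omega) (by omega)
    obtain ⟨f, hfe, hf⟩ := aux_extend (Sum.elim a b) hinj
      (Sum.elim (Fin.castLE hmk.le) (Fin.castLE hmk.le)) _ hsum (by
        intro i
        rw [aux_fiber_sum, aux_castLE_fiber]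
        split_ifs <;> omega)
    refine ⟨f, hf, fun i => ?_⟩
    by_cases hi : i.val < m
    · refine aux_acyclic_fiber3 G f i (by rw [hf i, if_pos hi]) (a ⟨i, hi⟩) (b ⟨i, hi⟩)
        (hfe (Sum.inl _)) (hfe (Sum.inr _)) (hab _).ne ?_
      exact ((SimpleGraph.compl_adj _ _ _).1 (hab _)).2
    · exact aux_acyclic_fiber2 G f i (by rw [hf i, if_neg hi])
  · have hdeg' : ∀ v, k + m ≤ Gᶜ.degree v := fun v => by have := hdeg v; omega
    obtain ⟨a, b, hinj, hab⟩ := aux_matching Gᶜ (k + m) hdeg' (by omega)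
    obtain ⟨p, q, hpq, hH⟩ := aux_double Gᶜ k m hmk.le (by omega) hdeg' a b hinj
    have hsum1 : ∑ i : Fin k, (1 + if i.val < m then 1 else 0) = Fintype.card (Fin (k + m)) := by
      rw [aux_target hmk.le]; simp
    obtain ⟨g, hge, hg⟩ := aux_extend (Sum.elim p q) hpq
      (Sum.elim (Fin.castLE hmk.le) (Fin.castLE hmk.le)) _ hsum1 (by
        intro i
        rw [aux_fiber_sum, aux_castLE_fiber]
        split_ifs <;> omega)
    obtain ⟨f, hfe, hf⟩ := aux_extend (Sum.elim a b) hinj (Sum.elim g g) _ hsum (by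
        intro i
        rw [aux_fiber_sum, hg]
        split_ifs <;> omega)
    have hfa : ∀ x, f (a x) = g x := fun x => hfe (Sum.inl x)
    have hfb : ∀ x, f (b x) = g x := fun x => hfe (Sum.inr x)
    have hna : ∀ x, ¬ G.Adj (a x) (b x) := fun x => ((SimpleGraph.compl_adj _ _ _).1 (hab x)).2
    have hainj : Function.Injective a := hinj.comp Sum.inl_injective
    have hbinj : Function.Injective b := hinj.comp Sum.inr_injective
    have hne : ∀ x y, a x ≠ b y := fun x y hxy => by
      have := @hinj (Sum.inl x) (Sum.inr y) hxy
      simp at this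
    refine ⟨f, hf, fun i => ?_⟩
    by_cases hi : i.val < m
    · have hgp : g (p ⟨i, hi⟩) = i := hge (Sum.inl ⟨i, hi⟩)
      have hgq : g (q ⟨i, hi⟩) = i := hge (Sum.inr ⟨i, hi⟩)
      have hne' : p ⟨i, hi⟩ ≠ q ⟨i, hi⟩ := fun hxy => by
        have := @hpq (Sum.inl _) (Sum.inr _) hxy
        simp at this
      refine aux_acyclic_fiber4 G f i (by rw [hf i, if_pos hi])
        (a (p ⟨i, hi⟩)) (b (p ⟨i, hi⟩)) (a (q ⟨i, hi⟩)) (b (q ⟨i, hi⟩))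
        (by rw [hfa, hgp]) (by rw [hfb, hgp]) (by rw [hfa, hgq]) (by rw [hfb, hgq])
        (hne _ _) (fun h => hne' (hainj h)) (hne _ _) (hne _ _).symm
        (fun h => hne' (hbinj h)) (hne _ _) (hna _) (hna _) ?_
      have := hH ⟨i, hi⟩
      simp only [SimpleGraph.compl_adj] at this
      tauto
    · have h1 : 0 < (Finset.univ.filter fun x => g x = i).card := by
        rw [hg i]; omega
      obtain ⟨x, hx⟩ := Finset.card_pos.1 h1
      have hx : g x = i := by simpa using hx
      exact aux_acyclic_fiber3 G f i (by rw [hf i, if_neg hi]) (a x) (b x)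
        (by rw [hfa, hx]) (by rw [hfb, hx]) (hne _ _) (hna _)
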